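/- For every r ∈ ℂ, every polynomial P ∈ ℂ[X], every sequence a : ℕ → ℂ, and every n ≥ 0, one has the operator identity (P(S − r)(T_r a))_n = (T_r (P(S) a))_n, where P(S − r) means the operator obtained by substituting the shift-minus-r operator into P; explicitly, writing Q(X) := P(X − r) with coefficients Q = ∑_j q_j X^j, this says ∑_j q_j (T_r a)_{n+j} = ∑_{k=0}^{n} C(n,k) r^{n-k} (∑_j c_j a_{k+j}) where P = ∑_j c_j X^j. -/

import Mathlib

open Polynomial

/-- The binomial-convolution operator `T_r`. -/
noncomputable def T (r : ℂ) (a : ℕ → ℂ) (n : ℕ) : ℂ :=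
  ∑ k ∈ Finset.range (n + 1), (n.choose k : ℂ) * r ^ (n - k) * a k

/-- The operator `P(S)` acting on sequences: `(P(S) a)_n = ∑_j c_j a_{n+j}`. -/
noncomputable def polyOp (P : Polynomial ℂ) (a : ℕ → ℂ) (n : ℕ) : ℂ :=
  ∑ j ∈ Finset.range (P.natDegree + 1), P.coeff j * a (n + j)

/-- The linear functional on polynomials sending `X ^ k` to `a k`. -/
noncomputable def umbral (a : ℕ → ℂ) : ℂ[X] →ₗ[ℂ] ℂ :=
  Polynomial.lsum fun k => a k • LinearMap.id

lemma umbral_C_mul_X_pow (a : ℕ → ℂ) (c : ℂ) (k : ℕ) : umbral a (C c * X ^ k) = c * a k := by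
  rw [umbral, lsum_apply, C_mul_X_pow_eq_monomial, sum_monomial_index] <;> simp [mul_comm]

lemma polyOp_eq_umbral (P : ℂ[X]) (a : ℕ → ℂ) (n : ℕ) :
    polyOp P a n = umbral a (P * X ^ n) := by
  conv_rhs => rw [P.as_sum_range_C_mul_X_pow]
  simp only [Finset.sum_mul, map_sum, mul_assoc, ← pow_add, umbral_C_mul_X_pow, polyOp,
    add_comm n]

lemma T_polyOp_eq_umbral (r : ℂ) (P : ℂ[X]) (a : ℕ → ℂ) (n : ℕ) :
    T r (polyOp P a) n = umbral a (P * (X + C r) ^ n) := by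
  rw [add_pow, Finset.mul_sum, map_sum, T]
  refine Finset.sum_congr rfl fun k _ => ?_
  rw [polyOp_eq_umbral, ← smul_eq_mul, ← map_smul, smul_eq_C_mul]
  congr 1
  simp only [C_mul, C_pow, map_natCast]
  ring

lemma polyOp_one (a : ℕ → ℂ) : polyOp 1 a = a := by
  ext n
  simp [polyOp]

lemma umbral_T (r : ℂ) (a : ℕ → ℂ) (P : ℂ[X]) :
    umbral (T r a) P = umbral a (P.comp (X + C r)) := by
  induction P using Polynomial.induction_on' with
  | add p q hp hq => rw [map_add, hp, hq, add_comp, map_add]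
  | monomial n c =>
    have h := T_polyOp_eq_umbral r 1 a n
    rw [polyOp_one, one_mul] at h
    rw [← C_mul_X_pow_eq_monomial, umbral_C_mul_X_pow, h, C_mul_comp, X_pow_comp,
      ← smul_eq_C_mul, map_smul, smul_eq_mul]

/-- Operator identity `P(S - r) ∘ T_r = T_r ∘ P(S)`. -/
theorem polyOp_intertwining (r : ℂ) (P : Polynomial ℂ) (a : ℕ → ℂ) (n : ℕ) :
    polyOp (P.comp (X - C r)) (T r a) n = T r (polyOp P a) n := by
  rw [polyOp_eq_umbral, umbral_T, T_polyOp_eq_umbral, mul_comp, comp_assoc, X_pow_comp]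
  simp
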